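/- If for every finite nonempty A ⊆ ℝ^Θ the function W_A is affine on T, then ∂T is identified: any two Borel probability measures on ∂T with the same barycenter are equal. -/

import Mathlib

open MeasureTheory Set

section Defs

variable {Θ : Type*} [Fintype Θ]

/-- The value function `v_A(s) = max_{a ∈ A} ∑_θ a(θ) s(θ)`. -/
noncomputable def valueFn (A : Set (Θ → ℝ)) (s : Θ → ℝ) : ℝ :=
  sSup ((fun a => ∑ θ, a θ * s θ) '' A)

/-- A binary set: one or two elements. -/
def Binary (A : Set (Θ → ℝ)) : Prop := A.ncard = 1 ∨ A.ncard = 2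

/-- An information structure on `S`: a Borel probability measure supported on `S`. -/
def IsInfoStructure (S : Set (Θ → ℝ)) (π : Measure (Θ → ℝ)) : Prop :=
  IsProbabilityMeasure π ∧ π Sᶜ = 0

/-- The skill distribution `p_π(θ) = ∫_S s(θ) dπ(s)` induced by `π`. -/
noncomputable def skillDist (S : Set (Θ → ℝ)) (π : Measure (Θ → ℝ)) : Θ → ℝ :=
  fun θ => ∫ s in S, s θ ∂π

/-- `S` is non-discriminatory. -/
def NonDiscriminatory (S : Set (Θ → ℝ)) : Prop :=
  ∀ π π' : Measure (Θ → ℝ), IsInfoStructure S π → IsInfoStructure S π' →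
    ∀ A : Set (Θ → ℝ), A.Finite → A.Nonempty →
      skillDist S π = skillDist S π' →
      ∫ t in S, valueFn A t ∂π = ∫ t in S, valueFn A t ∂π'

/-- `S` is non-discriminatory for binary sets. -/
def NonDiscriminatoryBinary (S : Set (Θ → ℝ)) : Prop :=
  ∀ π π' : Measure (Θ → ℝ), IsInfoStructure S π → IsInfoStructure S π' →
    ∀ A : Set (Θ → ℝ), Binary A →
      skillDist S π = skillDist S π' →
      ∫ t in S, valueFn A t ∂π = ∫ t in S, valueFn A t ∂π'

/-- `S` is identified. -/
def Identified (S : Set (Θ → ℝ)) : Prop :=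
  ∀ π π' : Measure (Θ → ℝ), IsInfoStructure S π → IsInfoStructure S π' →
    skillDist S π = skillDist S π' → π = π'

/-- `S` admits fair valuations. -/
def FairValuations (S : Set (Θ → ℝ)) : Prop :=
  ∀ A : Set (Θ → ℝ), A.Finite → A.Nonempty →
    ∃ α : Θ → ℝ, ∀ t ∈ S, valueFn A t = ∑ θ, α θ * t θ

/-- `S` admits fair valuations for binary sets. -/
def FairValuationsBinary (S : Set (Θ → ℝ)) : Prop :=
  ∀ A : Set (Θ → ℝ), Binary A →
    ∃ α : Θ → ℝ, ∀ t ∈ S, valueFn A t = ∑ θ, α θ * t θ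

/-- `W_A(p)`: value of optimal information design with skill distribution `p`,
over information structures on `S`. -/
noncomputable def Wfn (A S : Set (Θ → ℝ)) (p : Θ → ℝ) : ℝ :=
  sSup {x | ∃ π : Measure (Θ → ℝ), IsInfoStructure S π ∧ skillDist S π = p ∧
    x = ∫ t in S, valueFn A t ∂π}

/-- A function is affine on `T`. -/
def AffineOnSet (W : (Θ → ℝ) → ℝ) (T : Set (Θ → ℝ)) : Prop :=
  ∀ p ∈ T, ∀ q ∈ T, ∀ γ : ℝ, 0 ≤ γ → γ ≤ 1 →
    W (γ • p + (1 - γ) • q) = γ * W p + (1 - γ) * W q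

end Defs

section Helpers

/-- A probability measure supported in a closed convex set whose barycenter is an extreme point
of that set is concentrated at the barycenter. -/
theorem ae_eq_barycenter_of_mem_extremePoints {E : Type*} [NormedAddCommGroup E]
    [NormedSpace ℝ E] [CompleteSpace E] [MeasurableSpace E] {μ : Measure E}
    [IsProbabilityMeasure μ] {T : Set E} (hT : Convex ℝ T) (hTc : IsClosed T)
    (hμ : ∀ᵐ x ∂μ, x ∈ T) (hi : Integrable (fun x => x) μ) {e : E}
    (he : e ∈ T.extremePoints ℝ) (hbar : ∫ x, x ∂μ = e) : ∀ᵐ x ∂μ, x = e := by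
  refine Integrable.ae_eq_of_forall_setIntegral_eq (fun x => x) (fun _ => e) hi
    (integrable_const e) fun B hB _ => ?_
  rw [setIntegral_const]
  by_cases h0 : μ B = 0
  · simp [Measure.restrict_eq_zero.2 h0, measureReal_def, h0]
  by_cases h1 : μ Bᶜ = 0
  · have hBu : B =ᵐ[μ] univ := by rwa [ae_eq_univ]
    rw [setIntegral_congr_set hBu, setIntegral_univ, hbar, measureReal_congr hBu]
    simp
  have hseg := average_mem_openSegment_compl_self hB.nullMeasurableSet h0 h1 hi
  rw [average_eq_integral μ, hbar] at hseg
  have havg := he.2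
    (hT.set_average_mem hTc h0 (measure_ne_top _ _) (ae_restrict_of_ae hμ) hi.integrableOn)
    (hT.set_average_mem hTc h1 (measure_ne_top _ _) (ae_restrict_of_ae hμ) hi.integrableOn) hseg
  rw [← havg, measure_smul_setAverage _ (measure_ne_top _ _)]

variable {Θ : Type*}

theorem IsInfoStructure.ae_mem {S : Set (Θ → ℝ)} {π : Measure (Θ → ℝ)}
    (h : IsInfoStructure S π) : ∀ᵐ x ∂π, x ∈ S := h.2

theorem IsInfoStructure.restrict_eq {S : Set (Θ → ℝ)} {π : Measure (Θ → ℝ)}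
    (h : IsInfoStructure S π) : π.restrict S = π :=
  Measure.restrict_eq_self_of_ae_mem h.ae_mem

theorem isInfoStructure_dirac {S : Set (Θ → ℝ)} {e : Θ → ℝ} (he : e ∈ S)
    (hS : MeasurableSet S) : IsInfoStructure S (Measure.dirac e) :=
  ⟨inferInstance, by simp [Measure.dirac_apply' _ hS.compl, he]⟩

theorem AffineOnSet.map_sum {W : (Θ → ℝ) → ℝ} {T : Set (Θ → ℝ)} (hT : Convex ℝ T)
    (hW : AffineOnSet W T) {ι : Type*} (s : Finset ι) (w : ι → ℝ) (p : ι → Θ → ℝ)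
    (h0 : ∀ i ∈ s, 0 ≤ w i) (h1 : ∑ i ∈ s, w i = 1) (hp : ∀ i ∈ s, p i ∈ T) :
    W (∑ i ∈ s, w i • p i) = ∑ i ∈ s, w i * W (p i) := by
  have heq : ∀ x ∈ T, ∀ y ∈ T, ∀ a b : ℝ, 0 ≤ a → 0 ≤ b → a + b = 1 →
      W (a • x + b • y) = a • W x + b • W y := by
    intro x hx y hy a b ha hb hab
    obtain rfl : b = 1 - a := by linarith
    exact hW x hx y hy a ha (by linarith)
  have hconv : ConvexOn ℝ T W :=
    ⟨hT, fun x hx y hy a b ha hb hab => (heq x hx y hy a b ha hb hab).le⟩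
  have hconc : ConcaveOn ℝ T W :=
    ⟨hT, fun x hx y hy a b ha hb hab => (heq x hx y hy a b ha hb hab).ge⟩
  exact le_antisymm (hconv.map_sum_le h0 h1 hp) (hconc.le_map_sum h0 h1 hp)

theorem AffineOnSet.sum_mul_eq_zero {W : (Θ → ℝ) → ℝ} {T : Set (Θ → ℝ)} (hT : Convex ℝ T)
    (hW : AffineOnSet W T) {ι : Type*} (s : Finset ι) (c : ι → ℝ) (p : ι → Θ → ℝ)
    (hp : ∀ i ∈ s, p i ∈ T) (hc : ∑ i ∈ s, c i = 0) (hcp : ∑ i ∈ s, c i • p i = 0) :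
    ∑ i ∈ s, c i * W (p i) = 0 := by
  have hsub : ∀ i, c i = (c i)⁺ - (c i)⁻ := fun i => (posPart_sub_negPart (c i)).symm
  have hsum : ∑ i ∈ s, (c i)⁺ = ∑ i ∈ s, (c i)⁻ := by
    rw [← sub_eq_zero, ← Finset.sum_sub_distrib, ← hc]
    exact Finset.sum_congr rfl fun i _ => (hsub i).symm
  have hsump : ∑ i ∈ s, (c i)⁺ • p i = ∑ i ∈ s, (c i)⁻ • p i := by
    rw [← sub_eq_zero, ← Finset.sum_sub_distrib, ← hcp]
    exact Finset.sum_congr rfl fun i _ => by rw [← sub_smul, ← hsub]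
  have hpos : ∀ i ∈ s, 0 ≤ (c i)⁺ := fun i _ => posPart_nonneg _
  have hneg : ∀ i ∈ s, 0 ≤ (c i)⁻ := fun i _ => negPart_nonneg _
  obtain hC | hC := (Finset.sum_nonneg hpos).eq_or_lt
  · have h1 := (Finset.sum_eq_zero_iff_of_nonneg hpos).1 hC.symm
    have h2 := (Finset.sum_eq_zero_iff_of_nonneg hneg).1 (hsum ▸ hC.symm)
    exact Finset.sum_eq_zero fun i hi => by rw [hsub, h1 i hi, h2 i hi]; simp
  set C := ∑ i ∈ s, (c i)⁺
  have key : ∀ d : ι → ℝ, (∀ i ∈ s, 0 ≤ d i) → ∑ i ∈ s, d i = C →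
      ∑ i ∈ s, d i * W (p i) = C * W (C⁻¹ • ∑ i ∈ s, d i • p i) := by
    intro d hd hdC
    have h := hW.map_sum hT s (fun i => C⁻¹ * d i) p
      (fun i hi => mul_nonneg (inv_nonneg.2 hC.le) (hd i hi))
      (by rw [← Finset.mul_sum, hdC, inv_mul_cancel₀ hC.ne']) hp
    simp only [mul_smul, ← Finset.smul_sum, mul_assoc, ← Finset.mul_sum] at h
    rw [h, mul_inv_cancel_left₀ hC.ne']
  have h1 := key _ hpos rfl
  have h2 := key _ hneg hsum.symm
  calc ∑ i ∈ s, c i * W (p i) = ∑ i ∈ s, (c i)⁺ * W (p i) - ∑ i ∈ s, (c i)⁻ * W (p i) := by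
        rw [← Finset.sum_sub_distrib]
        exact Finset.sum_congr rfl fun i _ => by rw [← sub_mul, ← hsub]
    _ = 0 := by rw [h1, h2, hsump, sub_self]

variable [Fintype Θ]

theorem IsInfoStructure.integrable_id {S : Set (Θ → ℝ)} (hS : S ⊆ stdSimplex ℝ Θ)
    {π : Measure (Θ → ℝ)} (h : IsInfoStructure S π) : Integrable (fun x => x) π := by
  have := h.1
  obtain ⟨C, hC⟩ := (bounded_stdSimplex Θ).exists_norm_le
  refine Integrable.of_bound measurable_id.aestronglyMeasurable C ?_
  filter_upwards [h.ae_mem] with x hx using hC x (hS hx)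

theorem IsInfoStructure.skillDist_eq {S : Set (Θ → ℝ)} (hS : S ⊆ stdSimplex ℝ Θ)
    {π : Measure (Θ → ℝ)} (h : IsInfoStructure S π) : skillDist S π = ∫ x, x ∂π := by
  ext θ
  rw [skillDist, h.restrict_eq, eval_integral fun i => (h.integrable_id hS).eval i]

theorem Wfn_eq_valueFn {T : Set (Θ → ℝ)} (hTs : T ⊆ stdSimplex ℝ Θ) (hT : Convex ℝ T)
    (hTc : IsClosed T) (A : Set (Θ → ℝ)) {e : Θ → ℝ} (he : e ∈ T.extremePoints ℝ) :
    Wfn A T e = valueFn A e := by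
  have hd := isInfoStructure_dirac he.1 hTc.measurableSet
  have key : {x | ∃ π : Measure (Θ → ℝ), IsInfoStructure T π ∧ skillDist T π = e ∧
      x = ∫ t in T, valueFn A t ∂π} = {valueFn A e} := by
    ext x
    simp only [Set.mem_ofPred_eq, Set.mem_singleton_iff]
    constructor
    · rintro ⟨π, hπ, hbar, rfl⟩
      have := hπ.1
      rw [hπ.skillDist_eq hTs] at hbar
      have hae := ae_eq_barycenter_of_mem_extremePoints hT hTc hπ.ae_mem
        (hπ.integrable_id hTs) he hbar
      rw [hπ.restrict_eq, integral_congr_ae (g := fun _ => valueFn A e)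
        (by filter_upwards [hae] with x hx; rw [hx])]
      simp
    · rintro rfl
      refine ⟨_, hd, ?_, ?_⟩
      · rw [hd.skillDist_eq hTs, integral_dirac]
      · rw [hd.restrict_eq, integral_dirac]
  rw [Wfn, key, csSup_singleton]

/-- A point of the simplex outside a closed convex part of it is separated from it by an action
in the binary choice problem whose alternative is the zero action. -/
theorem exists_valueFn_pair_separating {K : Set (Θ → ℝ)} (hK : Convex ℝ K) (hKc : IsClosed K)
    (hKs : K ⊆ stdSimplex ℝ Θ) {e : Θ → ℝ} (he : e ∈ stdSimplex ℝ Θ) (heK : e ∉ K) :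
    ∃ a : Θ → ℝ, 0 < valueFn {0, a} e ∧ ∀ x ∈ K, valueFn {0, a} x = 0 := by
  classical
  obtain ⟨f, u, hf, hu⟩ := geometric_hahn_banach_closed_point hK hKc heK
  have hval : ∀ a x : Θ → ℝ, valueFn {0, a} x = max 0 (∑ θ, a θ * x θ) := by
    intro a x
    simp [valueFn, Set.image_pair]
  have hlin : ∀ x ∈ stdSimplex ℝ Θ, ∑ θ, (f (Pi.single θ 1) - u) * x θ = f x - u := by
    intro x hx
    have hfx := LinearMap.pi_apply_eq_sum_univ f.toLinearMap x
    simp only [sub_mul, Finset.sum_sub_distrib, ← Finset.mul_sum, hx.2, mul_one]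
    congr 1
    simp only [ContinuousLinearMap.coe_coe] at hfx
    rw [hfx]
    refine Finset.sum_congr rfl fun θ _ => ?_
    rw [smul_eq_mul, mul_comm]
    congr 2
    ext j
    simp [Pi.single_apply, eq_comm]
  refine ⟨fun θ => f (Pi.single θ 1) - u, ?_, fun x hx => ?_⟩
  · rw [hval, hlin e he]
    exact lt_max_of_lt_right (sub_pos.2 hu)
  · rw [hval, hlin x (hKs hx)]
    exact max_eq_left (sub_nonpos.2 (hf x hx).le)

theorem linearIndepOn_extremePoints {T : Set (Θ → ℝ)} (hTs : T ⊆ stdSimplex ℝ Θ)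
    (hT : Convex ℝ T) (hTc : IsClosed T)
    (haff : ∀ A : Set (Θ → ℝ), A.Finite → A.Nonempty → AffineOnSet (Wfn A T) T) :
    LinearIndepOn ℝ id (T.extremePoints ℝ) := by
  rw [linearIndepOn_iff']
  intro s c hs hcs e₀ he₀
  simp only [id] at hcs
  have hsT : ∀ e ∈ s, e ∈ T := fun e he => (hs he).1
  have hc : ∑ e ∈ s, c e = 0 := by
    have h := congrArg (fun x : Θ → ℝ => ∑ θ, x θ) hcs
    simp only [Finset.sum_apply, Pi.smul_apply, smul_eq_mul, Pi.zero_apply,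
      Finset.sum_const_zero] at h
    rw [Finset.sum_comm] at h
    rw [← h]
    refine Finset.sum_congr rfl fun e he => ?_
    rw [← Finset.mul_sum, (hTs (hsT e he)).2, mul_one]
  set K := convexHull ℝ ((s : Set (Θ → ℝ)) \ {e₀})
  have hKT : K ⊆ T := convexHull_min (fun e he => hsT e he.1) hT
  have heK : e₀ ∉ K := fun h =>
    (extremePoints_convexHull_subset
      (inter_extremePoints_subset_extremePoints_of_subset hKT ⟨h, hs he₀⟩)).2 rfl
  obtain ⟨a, hpos, hzero⟩ := exists_valueFn_pair_separating (convex_convexHull ℝ _)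
    (s.finite_toSet.sdiff.isClosed_convexHull ℝ) (hKT.trans hTs) (hTs (hsT e₀ he₀)) heK
  have h := (haff {0, a} (Set.toFinite _) ⟨0, by simp⟩).sum_mul_eq_zero hT s c id hsT hc hcs
  rw [Finset.sum_eq_single_of_mem e₀ he₀] at h
  · rw [id, Wfn_eq_valueFn hTs hT hTc _ (hs he₀)] at h
    exact (mul_eq_zero.1 h).resolve_right hpos.ne'
  · intro e he hne
    rw [id, Wfn_eq_valueFn hTs hT hTc _ (hs he),
      hzero e (subset_convexHull ℝ _ ⟨he, hne⟩), mul_zero]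

theorem identified_of_linearIndepOn {S : Set (Θ → ℝ)} (hSs : S ⊆ stdSimplex ℝ Θ)
    (hS : LinearIndepOn ℝ id S) : Identified S := by
  intro π π' hπ hπ' hbar
  have hfin : S.Finite := LinearIndependent.setFinite hS
  rw [hπ.skillDist_eq hSs, hπ'.skillDist_eq hSs] at hbar
  have hsing : ∀ e ∈ S, π {e} = π' {e} := by
    intro e he
    have hnot : e ∉ Submodule.span ℝ (S \ {e}) := by
      have h := (linearIndepOn_iff_notMem_span.1 hS) e he
      simpa using h
    obtain ⟨f, hf, hker⟩ := Submodule.exists_le_ker_of_notMem hnot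
    have hval : ∀ ρ : Measure (Θ → ℝ), IsInfoStructure S ρ →
        f (∫ x, x ∂ρ) = ρ.real {e} * f e := by
      intro ρ hρ
      have h := f.toContinuousLinearMap.integral_comp_comm (hρ.integrable_id hSs)
      simp only [LinearMap.coe_toContinuousLinearMap'] at h
      rw [← h, ← smul_eq_mul, ← integral_indicator_const (f e) (measurableSet_singleton e)]
      refine integral_congr_ae ?_
      filter_upwards [hρ.ae_mem] with x hx
      by_cases hxe : x = e
      · simp [hxe]
      · rw [Set.indicator_of_notMem (by simpa using hxe)]
        exact hker (Submodule.subset_span ⟨hx, hxe⟩)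
    have h := hval π hπ
    rw [hbar, hval π' hπ'] at h
    have := hπ.1
    have := hπ'.1
    exact ((measureReal_eq_measureReal_iff).1 (mul_right_cancel₀ hf h)).symm
  ext B -
  have hB : (B ∩ S).Finite := hfin.inter_of_right B
  have hsum : ∀ ρ : Measure (Θ → ℝ), IsInfoStructure S ρ →
      ρ B = ∑ x ∈ hB.toFinset, ρ {x} := by
    intro ρ hρ
    rw [sum_measure_singleton, hB.coe_toFinset]
    refine measure_congr ?_
    filter_upwards [hρ.ae_mem] with x hx
    exact propext ⟨fun h => ⟨h, hx⟩, fun h => h.1⟩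
  rw [hsum π hπ, hsum π' hπ']
  exact Finset.sum_congr rfl fun x hx => hsing x (hB.mem_toFinset.1 hx).2

end Helpers

variable {Θ : Type*} [Fintype Θ] [Nonempty Θ]

theorem stmt11 (𝒯 : Set (Θ → ℝ)) (h𝒯 : 𝒯 ⊆ stdSimplex ℝ Θ) (h𝒯c : IsClosed 𝒯)
    (haff : ∀ A : Set (Θ → ℝ), A.Finite → A.Nonempty →
      AffineOnSet (Wfn A (closure (convexHull ℝ 𝒯))) (closure (convexHull ℝ 𝒯))) :
    Identified (Set.extremePoints ℝ (closure (convexHull ℝ 𝒯))) := by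
  have hT : Convex ℝ (closure (convexHull ℝ 𝒯)) := (convex_convexHull ℝ 𝒯).closure
  have hTs : closure (convexHull ℝ 𝒯) ⊆ stdSimplex ℝ Θ :=
    closure_minimal (convexHull_min h𝒯 (convex_stdSimplex ℝ Θ)) (isClosed_stdSimplex ℝ Θ)
  exact identified_of_linearIndepOn (extremePoints_subset.trans hTs)
    (linearIndepOn_extremePoints hTs hT isClosed_closure haff)
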